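/- Let p_n denote the n-th prime, and let M be the additive submonoid of ℚ_{≥0}² generated by the set {(1/(2^n p_{2n}), 0) : n ∈ ℕ} ∪ {(1/(2^n p_{2n+1}), 1/p_{2n+1}) : n ∈ ℕ}. Then the two-element subset {(1,0), (1,1)} of M has no maximal common divisor in M; in particular, M is not a 2-MCD monoid. -/

import Mathlib

/-- The `n`-th prime (`n ≥ 1`), so `nthPrime 1 = 2`. -/
noncomputable def nthPrime (n : ℕ) : ℕ := Nat.nth Nat.Prime (n - 1)

/-- The defining generating set of the rank-2 monoid `M`:
`{(1/(2ⁿ p_{2n}), 0) : n ≥ 1} ∪ {(1/(2ⁿ p_{2n+1}), 1/p_{2n+1}) : n ≥ 1}`, where `pₖ`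
denotes the `k`-th prime. -/
noncomputable def genSet : Set (ℚ × ℚ) :=
  {x | ∃ n : ℕ, 1 ≤ n ∧
    (x = ((1 : ℚ) / (2 ^ n * (nthPrime (2 * n) : ℚ)), 0) ∨
      x = ((1 : ℚ) / (2 ^ n * (nthPrime (2 * n + 1) : ℚ)), 1 / (nthPrime (2 * n + 1) : ℚ)))}

/-- `c` divides `b` in the submonoid `M` of `ℚ≥0 × ℚ≥0`. -/
def DvdIn (M : AddSubmonoid (ℚ × ℚ)) (c b : ℚ × ℚ) : Prop := ∃ e ∈ M, b = c + e

/-- `u` is an invertible element (unit) of the monoid `M`. -/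
def IsUnitIn (M : AddSubmonoid (ℚ × ℚ)) (u : ℚ × ℚ) : Prop := u ∈ M ∧ ∃ v ∈ M, u + v = 0

/-- `d` is a maximal common divisor of the subset `S` of `M`: `d ∈ M` is a common divisor
of `S` in `M`, and every common divisor in `M` of `{s - d : s ∈ S}` is a unit of `M`. -/
def IsMCDIn (M : AddSubmonoid (ℚ × ℚ)) (d : ℚ × ℚ) (S : Set (ℚ × ℚ)) : Prop :=
  d ∈ M ∧ (∀ s ∈ S, DvdIn M d s) ∧
    ∀ e ∈ M, (∀ s ∈ S, DvdIn M e (s - d)) → IsUnitIn M e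

/-- If a sum of fractions with distinct prime denominators is an integer, then each
denominator divides its numerator. -/
theorem prime_dvd_of_sum_div_eq_int {ι : Type*} [DecidableEq ι] (q f : ι → ℕ)
    (hq : ∀ i, (q i).Prime) (hinj : Function.Injective q) (s : Finset ι) (k : ℤ)
    (h : ∑ i ∈ s, (f i : ℚ) / q i = k) {i : ι} (hi : i ∈ s) : q i ∣ f i := by
  have hq0 : ∀ j, (q j : ℚ) ≠ 0 := fun j => by exact_mod_cast (hq j).ne_zero
  set P : ℕ := ∏ j ∈ s.erase i, q j with hP
  set N : ℕ := ∑ j ∈ s.erase i, f j * ∏ l ∈ (s.erase i).erase j, q l with hN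
  have hsum : (∑ j ∈ s.erase i, (f j : ℚ) / q j) * P = N := by
    rw [hN, Finset.sum_mul]
    push_cast
    refine Finset.sum_congr rfl fun j hj => ?_
    rw [hP, ← Finset.mul_prod_erase _ _ hj]
    have := hq0 j
    push_cast
    field_simp
  rw [← Finset.add_sum_erase _ _ hi] at h
  have key : (f i : ℚ) * P = q i * (k * P - N) := by
    have := hq0 i
    rw [← hsum, ← h]
    field_simp
    ring
  have hdvd : (q i : ℤ) ∣ ((f i * P : ℕ) : ℤ) := ⟨k * P - N, by exact_mod_cast key⟩
  refine Nat.Coprime.dvd_of_dvd_mul_right ?_ (Int.natCast_dvd_natCast.mp hdvd)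
  refine Nat.Coprime.prod_right fun j hj => (Nat.coprime_primes (hq i) (hq j)).mpr ?_
  exact fun hij => (Finset.ne_of_mem_erase hj) (hinj hij).symm

theorem nthPrime_prime (n : ℕ) : (nthPrime n).Prime := Nat.prime_nth_prime _

theorem nthPrime_cast_ne_zero (n : ℕ) : (nthPrime n : ℚ) ≠ 0 := by
  exact_mod_cast (nthPrime_prime n).ne_zero

theorem nthPrime_odd_index_injective :
    Function.Injective fun n : ℕ => nthPrime (2 * (n + 1) + 1) := by
  intro a b hab
  have := Nat.nth_injective Nat.infinite_setOfPred_prime hab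
  omega

/-- The generators of `genSet` with nonzero second coordinate, indexed from `0`. -/
noncomputable def oddGen (n : ℕ) : ℚ × ℚ :=
  ((1 : ℚ) / (2 ^ (n + 1) * (nthPrime (2 * (n + 1) + 1) : ℚ)),
    1 / (nthPrime (2 * (n + 1) + 1) : ℚ))

theorem oddGen_mem (n : ℕ) : oddGen n ∈ AddSubmonoid.closure genSet :=
  AddSubmonoid.subset_closure ⟨n + 1, by omega, Or.inr rfl⟩

theorem nthPrime_nsmul_oddGen (n : ℕ) :
    nthPrime (2 * (n + 1) + 1) • oddGen n = (1 / 2 ^ (n + 1), 1) := by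
  have := nthPrime_cast_ne_zero (2 * (n + 1) + 1)
  ext <;> simp only [oddGen, Prod.smul_mk, nsmul_eq_mul] <;> field_simp

theorem one_div_two_pow_one_mem (n : ℕ) :
    ((1 / 2 ^ (n + 1), 1) : ℚ × ℚ) ∈ AddSubmonoid.closure genSet :=
  nthPrime_nsmul_oddGen n ▸ nsmul_mem (oddGen_mem n) _

theorem one_div_two_pow_zero_mem (n : ℕ) :
    ((1 / 2 ^ (n + 1), 0) : ℚ × ℚ) ∈ AddSubmonoid.closure genSet := by
  have hg : (((1 : ℚ) / (2 ^ (n + 1) * (nthPrime (2 * (n + 1)) : ℚ)), 0) : ℚ × ℚ) ∈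
      AddSubmonoid.closure genSet :=
    AddSubmonoid.subset_closure ⟨n + 1, by omega, Or.inl rfl⟩
  have := nthPrime_cast_ne_zero (2 * (n + 1))
  convert nsmul_mem hg (nthPrime (2 * (n + 1))) using 1
  ext
  · simp only [Prod.smul_mk, nsmul_eq_mul]
    field_simp
  · simp

theorem nonneg_of_mem_closure_genSet {x : ℚ × ℚ} (hx : x ∈ AddSubmonoid.closure genSet) :
    0 ≤ x := by
  induction hx using AddSubmonoid.closure_induction with
  | mem x hx =>
    obtain ⟨n, -, rfl | rfl⟩ := hx
    · exact ⟨by simp only [Prod.fst_zero]; positivity, le_rfl⟩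
    · exact ⟨by simp only [Prod.fst_zero]; positivity,
        by simp only [Prod.snd_zero]; positivity⟩
  | zero => exact le_rfl
  | add x y _ _ hx hy => exact add_nonneg hx hy

theorem exists_add_sum_oddGen {x : ℚ × ℚ} (hx : x ∈ AddSubmonoid.closure genSet) :
    ∃ u ∈ AddSubmonoid.closure genSet, u.2 = 0 ∧ ∃ f : ℕ →₀ ℕ,
      x = u + f.sum fun n c => c • oddGen n := by
  induction hx using AddSubmonoid.closure_induction with
  | mem x hx =>
    have hx' := hx
    obtain ⟨n, hn, rfl | rfl⟩ := hx'
    · exact ⟨_, AddSubmonoid.subset_closure hx, rfl, 0, by simp⟩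
    · obtain ⟨n, rfl⟩ := Nat.exists_eq_add_of_le' hn
      exact ⟨0, zero_mem _, rfl, Finsupp.single n 1, by simp [oddGen]⟩
  | zero => exact ⟨0, zero_mem _, rfl, 0, by simp⟩
  | add x y _ _ hx hy =>
    obtain ⟨u, hu, hu0, f, rfl⟩ := hx
    obtain ⟨v, hv, hv0, g, rfl⟩ := hy
    refine ⟨u + v, add_mem hu hv, by simp [hu0, hv0], f + g, ?_⟩
    rw [Finsupp.sum_add_index' (by simp) (by simp [add_smul])]
    abel

theorem exists_eq_add_of_snd_eq_one {x : ℚ × ℚ} (hx : x ∈ AddSubmonoid.closure genSet)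
    (hx1 : x.2 = 1) : ∃ n : ℕ, ∃ w ∈ AddSubmonoid.closure genSet,
      x = w + (1 / 2 ^ (n + 1), 1) := by
  obtain ⟨u, hu, hu0, f, rfl⟩ := exists_add_sum_oddGen hx
  have hsum : ∑ n ∈ f.support, (f n : ℚ) / nthPrime (2 * (n + 1) + 1) = (1 : ℤ) := by
    simpa [hu0, Finsupp.sum, Prod.snd_sum, oddGen, div_eq_mul_inv] using hx1
  obtain ⟨n, hn⟩ : f.support.Nonempty := by
    rw [Finset.nonempty_iff_ne_empty]
    intro h
    simp [h] at hsum
  obtain ⟨c, hc⟩ := prime_dvd_of_sum_div_eq_int (fun n => nthPrime (2 * (n + 1) + 1)) f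
    (fun _ => nthPrime_prime _) nthPrime_odd_index_injective _ _ hsum hn
  obtain ⟨c, rfl⟩ : ∃ b, c = b + 1 := Nat.exists_eq_succ_of_ne_zero <| by
    rintro rfl
    exact Finsupp.mem_support_iff.mp hn (by simpa using hc)
  refine ⟨n, u + ((nthPrime (2 * (n + 1) + 1) * c) • oddGen n +
    ∑ m ∈ f.support.erase n, f m • oddGen m), ?_, ?_⟩
  · exact add_mem hu (add_mem (nsmul_mem (oddGen_mem n) _)
      (sum_mem fun m _ => nsmul_mem (oddGen_mem m) _))
  · rw [Finsupp.sum, ← Finset.add_sum_erase _ _ hn, hc, ← nthPrime_nsmul_oddGen, mul_add,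
      add_smul, mul_one]
    abel

theorem not_exists_isMCDIn_closure_genSet :
    ¬ ∃ d, IsMCDIn (AddSubmonoid.closure genSet) d {((1 : ℚ), (0 : ℚ)), ((1 : ℚ), (1 : ℚ))} := by
  rintro ⟨d, hd, hdvd, hmax⟩
  obtain ⟨y, hy, hdy⟩ := hdvd (1, 0) (by simp)
  obtain ⟨z, hz, hdz⟩ := hdvd (1, 1) (by simp)
  have hd0 : d.2 = 0 := by
    have h1 : 0 ≤ d.2 := (nonneg_of_mem_closure_genSet hd).2
    have h2 : 0 ≤ y.2 := (nonneg_of_mem_closure_genSet hy).2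
    have h3 : (0 : ℚ) = d.2 + y.2 := congrArg Prod.snd hdy
    linarith
  have hz1 : z.2 = 1 := by
    have h : (1 : ℚ) = d.2 + z.2 := congrArg Prod.snd hdz
    linarith
  obtain ⟨n, w, hw, rfl⟩ := exists_eq_add_of_snd_eq_one hz hz1
  have hfst : (1 : ℚ) = d.1 + (w.1 + 1 / 2 ^ (n + 1)) := congrArg Prod.fst hdz
  have hw0 : w.2 = 0 := by simpa using hz1
  have hhalf : (1 : ℚ) / 2 ^ (n + 1) = 1 / 2 ^ (n + 1 + 1) + 1 / 2 ^ (n + 1 + 1) := by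
    field_simp
    ring
  have hunit := hmax (1 / 2 ^ (n + 1 + 1), 0) (one_div_two_pow_zero_mem (n + 1)) <| by
    rintro s (rfl | rfl)
    · refine ⟨w + (1 / 2 ^ (n + 1 + 1), 0), add_mem hw (one_div_two_pow_zero_mem (n + 1)), ?_⟩
      ext
      · simp only [Prod.fst_sub, Prod.fst_add]
        linarith
      · simp [hd0, hw0]
    · refine ⟨w + (1 / 2 ^ (n + 1 + 1), 1), add_mem hw (one_div_two_pow_one_mem (n + 1)), ?_⟩
      ext
      · simp only [Prod.fst_sub, Prod.fst_add]
        linarith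
      · simp [hd0, hw0]
  obtain ⟨-, v, hv, hv0⟩ := hunit
  have h1 : 0 ≤ v.1 := (nonneg_of_mem_closure_genSet hv).1
  have h2 : (1 : ℚ) / 2 ^ (n + 1 + 1) + v.1 = 0 := congrArg Prod.fst hv0
  have h3 : (0 : ℚ) < 1 / 2 ^ (n + 1 + 1) := by positivity
  linarith

/-- In the atomic submonoid `M` of `ℚ≥0²` generated by
`{(1/(2ⁿ p_{2n}), 0), (1/(2ⁿ p_{2n+1}), 1/p_{2n+1}) : n ≥ 1}` (with `pₖ` the `k`-th
prime), the two-element subset `{(1,0), (1,1)}` of `M` has no maximal common divisor;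
in particular, `M` is not a 2-MCD monoid. -/
theorem rank2_example_not_two_mcd (M : AddSubmonoid (ℚ × ℚ))
    (hM : M = AddSubmonoid.closure genSet) :
    ((1 : ℚ), (0 : ℚ)) ∈ M ∧ ((1 : ℚ), (1 : ℚ)) ∈ M ∧
      (¬ ∃ d, IsMCDIn M d {((1 : ℚ), (0 : ℚ)), ((1 : ℚ), (1 : ℚ))}) ∧
      ¬ ∀ S : Set (ℚ × ℚ), S ⊆ (M : Set (ℚ × ℚ)) → S.ncard = 2 →
        ∃ d, IsMCDIn M d S := by
  subst hM
  have h10 : ((1 : ℚ), (0 : ℚ)) ∈ AddSubmonoid.closure genSet := by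
    convert nsmul_mem (one_div_two_pow_zero_mem 0) 2 using 1
    ext <;> simp
  have h11 : ((1 : ℚ), (1 : ℚ)) ∈ AddSubmonoid.closure genSet := by
    convert add_mem (one_div_two_pow_zero_mem 0) (one_div_two_pow_one_mem 0) using 1
    ext
    · norm_num
    · simp
  refine ⟨h10, h11, not_exists_isMCDIn_closure_genSet, fun h => ?_⟩
  refine not_exists_isMCDIn_closure_genSet (h _ ?_ (Set.ncard_pair (by simp)))
  rintro s (rfl | rfl)
  exacts [h10, h11]
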